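/- Let Δ be a closed analytic Jordan arc with endpoints ±1 and let {v_n} ∈ V_P(Δ) with associated functions r_n. Then there exists a bounded open neighborhood Ω of Δ in ℂ such that for every q ∈ [1,∞) there is a constant C_q with ( ∬_{Ω\Δ} |r_n(z)|^q dA(z) )^{1/q} ≤ C_q · n^{-1/q} for all n large enough, where dA denotes planar Lebesgue (area) measure. -/

import Mathlib

open Complex MeasureTheory Filter Topology Set Metric Polynomial
open scoped ENNReal NNReal

noncomputable section

/-- The segment `[-1,1]` viewed inside `ℂ`. -/
def realSeg : Set ℂ := (fun x : ℝ => (x : ℂ)) '' Set.Icc (-1) 1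

/-- A closed analytic Jordan arc with endpoints `-1` and `1`: the image of `[-1,1]`
under a holomorphic univalent map defined on a neighborhood of `[-1,1]`. -/
structure AnalyticArc where
  U : Set ℂ
  Ξ : ℂ → ℂ
  isOpen_U : IsOpen U
  seg_sub : realSeg ⊆ U
  diff : DifferentiableOn ℂ Ξ U
  inj : Set.InjOn Ξ U
  map_neg_one : Ξ (-1) = -1
  map_one : Ξ 1 = 1

/-- The arc itself. -/
def AnalyticArc.arc (A : AnalyticArc) : Set ℂ := A.Ξ '' realSeg

/-- The open arc `Δ° = Δ \ {±1}`. -/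
def AnalyticArc.arcInt (A : AnalyticArc) : Set ℂ := A.arc \ {1, -1}

/-- Boundary value from the left (`+`) side of the arc. -/
def BVplus {E : Type*} [TopologicalSpace E] (Ξ : ℂ → ℂ) (f : ℂ → E) (fp : ℂ → E) : Prop :=
  ∀ x ∈ Set.Ioo (-1:ℝ) 1,
    Tendsto (fun y : ℝ => f (Ξ (x + y * Complex.I))) (𝓝[>] 0) (𝓝 (fp (Ξ (x:ℂ))))

/-- Boundary value from the right (`-`) side of the arc. -/
def BVminus {E : Type*} [TopologicalSpace E] (Ξ : ℂ → ℂ) (f : ℂ → E) (fm : ℂ → E) : Prop :=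
  ∀ x ∈ Set.Ioo (-1:ℝ) 1,
    Tendsto (fun y : ℝ => f (Ξ (x + y * Complex.I))) (𝓝[<] 0) (𝓝 (fm (Ξ (x:ℂ))))

/-- The branch of `√(z²-1)` holomorphic off the arc with `sr z / z → 1` at infinity. -/
structure SqrtBranch (A : AnalyticArc) where
  sr : ℂ → ℂ
  diff : DifferentiableOn ℂ sr A.arcᶜ
  sq : ∀ z ∈ A.arcᶜ, sr z ^ 2 = z ^ 2 - 1
  at_inf : Tendsto (fun z => sr z / z) (Bornology.cobounded ℂ) (𝓝 1)

/-- `φ(z) = z + sr z`. -/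
def SqrtBranch.φ {A : AnalyticArc} (S : SqrtBranch A) (z : ℂ) : ℂ := z + S.sr z

/-- The function `r_n` associated to a polynomial `v` with no zeros on the arc. -/
def rFun {A : AnalyticArc} (S : SqrtBranch A) (v : Polynomial ℂ) (n : ℕ) (z : ℂ) : ℂ :=
  (1 / S.φ z) ^ (2 * n - v.natDegree) *
    ((v.roots.map fun e => (S.φ z - S.φ e) / (1 - S.φ e * S.φ z)).prod)

instance : MeasurableSpace (OnePoint ℂ) := borel _

/-- Normalized counting measure (on the Riemann sphere) of the zeros of `r_n`:
the zeros of `v_n` together with a zero of multiplicity `2n - deg v_n` at infinity. -/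
def zeroMeasure (v : Polynomial ℂ) (n : ℕ) : Measure (OnePoint ℂ) :=
  (((2 * n : ℕ) : ℝ≥0∞))⁻¹ •
    ((v.roots.map fun e => Measure.dirac ((e : ℂ) : OnePoint ℂ)).sum
      + (((2 * n - v.natDegree : ℕ) : ℝ≥0∞)) • Measure.dirac (OnePoint.infty : OnePoint ℂ))

/-- The class `V_P(Δ)` of interpolation schemes, together with the boundary
values of the associated functions `r_n`. -/
structure VPData (A : AnalyticArc) (S : SqrtBranch A) where
  v : ℕ → Polynomial ℂ
  deg_le : ∀ n, (v n).natDegree ≤ 2 * n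
  no_zero_on : ∀ n, ∀ z ∈ A.arc, (v n).eval z ≠ 0
  rp : ℕ → ℂ → ℂ
  rm : ℕ → ℂ → ℂ
  bvp : ∀ n, BVplus A.Ξ (rFun S (v n) n) (rp n)
  bvm : ∀ n, BVminus A.Ξ (rFun S (v n) n) (rm n)
  bdd : ∃ C : ℝ, ∀ n, ∀ t ∈ A.arc, ‖rp n t‖ ≤ C ∧ ‖rm n t‖ ≤ C
  small : ∀ K, IsCompact K → K ⊆ A.arcᶜ →
    TendstoUniformlyOn (fun n z => rFun S (v n) n z) 0 Filter.atTop K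
  zero_free : ∃ N : Set ℂ, IsOpen N ∧ A.arc ⊆ N ∧ ∃ n₀ : ℕ, ∀ n ≥ n₀, ∀ z ∈ N, (v n).eval z ≠ 0
  weakstar : ∃ ν : Measure (OnePoint ℂ), ∀ f : C(OnePoint ℂ, ℝ),
    Tendsto (fun n => ∫ x, f x ∂(zeroMeasure (v n) n)) Filter.atTop (𝓝 (∫ x, f x ∂ν))

section AreaBound

open scoped Real ComplexConjugate

theorem exists_exp_eq_of_convex {V : Set ℂ} (hV : Convex ℝ V) (hVo : IsOpen V) {f : ℂ → ℂ}
    (hf : DifferentiableOn ℂ f V) (h0 : ∀ z ∈ V, f z ≠ 0) :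
    ∃ h : ℂ → ℂ, DifferentiableOn ℂ h V ∧ ∀ z ∈ V, exp (h z) = f z := by
  rcases V.eq_empty_or_nonempty with rfl | ⟨z₀, hz₀⟩
  · exact ⟨0, by simp, by simp⟩
  have hd : DifferentiableOn ℂ (fun z => deriv f z / f z) V := (hf.deriv hVo).div hf h0
  obtain ⟨g, hg⟩ := hV.exists_forall_hasDerivWithinAt hd
  have hg' : ∀ z ∈ V, HasDerivAt g (deriv f z / f z) z := fun z hz =>
    (hg z hz).hasDerivAt (hVo.mem_nhds hz)
  have hf' : ∀ z ∈ V, HasDerivAt f (deriv f z) z := fun z hz =>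
    (hf.differentiableAt (hVo.mem_nhds hz)).hasDerivAt
  have hq : ∀ z ∈ V, HasDerivAt (fun z => f z * exp (-g z)) 0 z := fun z hz => by
    convert! (hf' z hz).mul ((hg' z hz).neg.cexp) using 1
    have := h0 z hz
    field_simp
    simp
  have hconst : ∀ z ∈ V, f z * exp (-g z) = f z₀ * exp (-g z₀) := fun z hz =>
    hVo.is_const_of_deriv_eq_zero hV.isPreconnected
      (fun w hw => (hq w hw).differentiableAt.differentiableWithinAt)
      (fun w hw => (hq w hw).deriv) hz hz₀
  refine ⟨fun z => g z + log (f z₀ * exp (-g z₀)), ?_, fun z hz => ?_⟩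
  · exact fun z hz => ((hg' z hz).add_const _).differentiableAt.differentiableWithinAt
  · rw [exp_add, exp_log (mul_ne_zero (h0 _ hz₀) (exp_ne_zero _)), ← hconst z hz, mul_comm,
      mul_assoc, ← exp_add]
    simp

theorem deriv_ne_zero_of_injOn {V : Set ℂ} (hVo : IsOpen V) {f : ℂ → ℂ}
    (hf : DifferentiableOn ℂ f V) (hinj : InjOn f V) {z₀ : ℂ} (hz₀ : z₀ ∈ V) :
    deriv f z₀ ≠ 0 := by
  intro hd
  have hfa : AnalyticAt ℂ (fun z => f z - f z₀) z₀ :=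
    (hf.analyticAt (hVo.mem_nhds hz₀)).sub analyticAt_const
  have hne : ¬ ∀ᶠ z in 𝓝 z₀, f z - f z₀ = 0 := by
    intro h
    have h1 : ∀ᶠ z in 𝓝[≠] z₀, f z - f z₀ = 0 := h.filter_mono nhdsWithin_le_nhds
    have h2 : ∀ᶠ z in 𝓝[≠] z₀, z ∈ V := nhdsWithin_le_nhds (hVo.mem_nhds hz₀)
    obtain ⟨z, ⟨hz1, hz2⟩, hz3⟩ := ((h1.and h2).and self_mem_nhdsWithin).exists
    exact hz3 (hinj hz2 hz₀ (sub_eq_zero.1 hz1))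
  obtain ⟨n, g, hga, hg0, hfg⟩ := (hfa.exists_eventuallyEq_pow_smul_nonzero_iff).2 hne
  have hn0 : n ≠ 0 := by
    rintro rfl
    have := hfg.self_of_nhds
    simp at this
    exact hg0 this.symm
  have hn1 : n ≠ 1 := by
    rintro rfl
    have h1 : HasDerivAt (fun z => (z - z₀) ^ 1 • g z) (g z₀) z₀ := by
      convert! ((hasDerivAt_id z₀).sub_const z₀).mul hga.differentiableAt.hasDerivAt using 1
      · ext z; simp
      · simp
    have h2 := h1.congr_of_eventuallyEq hfg
    have h3 : HasDerivAt (fun z => f z - f z₀) 0 z₀ := by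
      have := (hf.differentiableAt (hVo.mem_nhds hz₀)).hasDerivAt
      rw [hd] at this
      exact this.sub_const _
    exact hg0 (h2.unique h3)
  have hn2 : 1 < n := by omega
  set p : ℂ → ℂ := fun z => (g z₀) ^ (1 / n : ℂ) * (g z / g z₀) ^ (1 / n : ℂ) with hp
  have hslit : g z₀ / g z₀ ∈ slitPlane := by simp [hg0]
  have hpa : AnalyticAt ℂ p z₀ :=
    analyticAt_const.mul ((hga.div analyticAt_const hg0).cpow analyticAt_const hslit)
  have hpn : ∀ z, p z ^ n = g z := fun z => by
    simp only [hp, mul_pow, one_div, cpow_nat_inv_pow _ hn0]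
    field_simp
  have hp0 : p z₀ ≠ 0 := fun h => hg0 (by rw [← hpn, h, zero_pow hn0])
  have hψ : HasStrictDerivAt (fun z => (z - z₀) * p z) (p z₀) z₀ := by
    have h1 : HasStrictDerivAt (fun z : ℂ => z - z₀) 1 z₀ :=
      (hasStrictDerivAt_id z₀).sub_const z₀
    convert! h1.mul hpa.hasStrictDerivAt using 1
    simp
  have hmap := hψ.map_nhds_eq hp0
  simp only [sub_self, zero_mul] at hmap
  set ω : ℂ := exp (2 * π * I / n) with hω
  have hprim : IsPrimitiveRoot ω n := Complex.isPrimitiveRoot_exp n hn0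
  have hgood : ∀ᶠ z in 𝓝 z₀, z ∈ V ∧ f z - f z₀ = ((z - z₀) * p z) ^ n := by
    filter_upwards [hfg, hVo.mem_nhds hz₀] with z h1 h2
    exact ⟨h2, by rw [h1, mul_pow, hpn, smul_eq_mul]⟩
  have himg : ∀ᶠ w in 𝓝 (0 : ℂ), ∃ z, (z - z₀) * p z = w ∧ z ∈ V ∧
      f z - f z₀ = ((z - z₀) * p z) ^ n := by
    rw [← hmap]
    exact (hgood.mono fun z hz => ⟨z, rfl, hz⟩)
  have himg2 : ∀ᶠ w in 𝓝 (0 : ℂ), ∃ z, (z - z₀) * p z = ω * w ∧ z ∈ V ∧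
      f z - f z₀ = ((z - z₀) * p z) ^ n := by
    have : Tendsto (fun w : ℂ => ω * w) (𝓝 0) (𝓝 0) := by
      have h : Continuous fun w : ℂ => ω * w := by fun_prop
      simpa using h.tendsto 0
    exact this.eventually himg
  have hall : ∀ᶠ w in 𝓝[≠] (0 : ℂ), _ := (himg.and himg2).filter_mono nhdsWithin_le_nhds
  obtain ⟨w, ⟨⟨z, hz1, hz2, hz3⟩, z', hz1', hz2', hz3'⟩, hw⟩ :=
    (hall.and self_mem_nhdsWithin).exists
  have hfe : f z = f z' := by
    rw [hz1] at hz3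
    rw [hz1', mul_pow, hprim.pow_eq_one, one_mul, ← hz3] at hz3'
    exact (sub_left_inj.1 hz3').symm
  have hzz := hinj hz2 hz2' hfe
  rw [← hzz, hz1] at hz1'
  have : ω = 1 := by
    have hw' : w ≠ 0 := hw
    exact (mul_eq_right₀ hw').1 hz1'.symm
  exact hprim.ne_one hn2 this

theorem norm_deriv_le_of_re_pos {f : ℂ → ℂ} {c : ℂ} {r : ℝ} (hr : 0 < r)
    (hf : DifferentiableOn ℂ f (ball c r)) (hpos : ∀ z ∈ ball c r, 0 < (f z).re) :
    ‖deriv f c‖ ≤ 2 / r * (f c).re := by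
  have hc : c ∈ ball c r := mem_ball_self hr
  have hfc := hpos c hc
  have hden : ∀ z ∈ ball c r, f z + conj (f c) ≠ 0 := fun z hz h => by
    have := congrArg re h
    simp at this
    linarith [hpos z hz]
  have hgd : DifferentiableOn ℂ (fun z => (f z - f c) / (f z + conj (f c))) (ball c r) :=
    (hf.sub_const _).div (hf.add_const _) hden
  have hb := norm_deriv_le_div_of_mapsTo_ball (R₂ := 1) hgd (fun z hz => by
    simp only [sub_self, zero_div, mem_closedBall, dist_zero_right, norm_div]
    refine div_le_one_of_le₀ ?_ (norm_nonneg _)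
    rw [← sq_le_sq₀ (norm_nonneg _) (norm_nonneg _), Complex.sq_norm, Complex.sq_norm,
      normSq_apply, normSq_apply]
    simp
    nlinarith [hpos z hz]) hr
  have hder : HasDerivAt (fun z => (f z - f c) / (f z + conj (f c)))
      (deriv f c / (2 * (f c).re : ℝ)) c := by
    have h1 := (hf.differentiableAt (ball_mem_nhds c hr)).hasDerivAt
    convert! (h1.sub_const (f c)).div (h1.add_const (conj (f c))) (hden c hc) using 1
    have : f c + conj (f c) = ((2 * (f c).re : ℝ) : ℂ) := by rw [add_conj]
    have h2 : ((2 * (f c).re : ℝ) : ℂ) ≠ 0 := by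
      exact_mod_cast (by positivity : (2 * (f c).re) ≠ 0)
    rw [this]
    field_simp
    simp
  rw [hder.deriv, norm_div, Complex.norm_real, Real.norm_of_nonneg (by positivity),
    div_le_iff₀ (by positivity)] at hb
  calc _ ≤ _ := hb
    _ = _ := by ring

/-- `g` lifts through `exp` to a continuous function whose increment over each interval of
length `2π` is `k`. -/
def HasWinding (g : ℝ → ℂ) (k : ℂ) : Prop :=
  ∃ l : ℝ → ℂ, Continuous l ∧ (∀ y, exp (l y) = g y) ∧ ∀ y, l (y + 2 * π) = l y + k

theorem eq_zero_apply_of_exp_eq_one {l : ℝ → ℂ} (hl : Continuous l) (h : ∀ y, exp (l y) = 1)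
    (y : ℝ) : l y = l 0 := by
  refine isCoveringMap_exp.const_of_comp hl (fun a b => ?_) y 0
  simp [h]

theorem HasWinding.mul {g₁ g₂ : ℝ → ℂ} {k₁ k₂ : ℂ} (h₁ : HasWinding g₁ k₁)
    (h₂ : HasWinding g₂ k₂) : HasWinding (fun y => g₁ y * g₂ y) (k₁ + k₂) := by
  obtain ⟨l₁, c₁, e₁, p₁⟩ := h₁
  obtain ⟨l₂, c₂, e₂, p₂⟩ := h₂
  refine ⟨fun y => l₁ y + l₂ y, c₁.add c₂, fun y => ?_, fun y => ?_⟩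
  · rw [exp_add, e₁, e₂]
  · simp only [p₁, p₂]; ring

theorem hasWinding_one : HasWinding (fun _ => 1) 0 := ⟨0, continuous_zero, by simp, by simp⟩

theorem hasWinding_of_mem_slitPlane {g : ℝ → ℂ} (hc : Continuous g) (hs : ∀ y, g y ∈ slitPlane)
    (hp : ∀ y, g (y + 2 * π) = g y) : HasWinding g 0 :=
  ⟨fun y => log (g y), hc.clog hs, fun y => exp_log (slitPlane_ne_zero (hs y)),
    fun y => by simp [hp]⟩

theorem HasWinding.unique {g : ℝ → ℂ} {k₁ k₂ : ℂ} (h₁ : HasWinding g k₁)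
    (h₂ : HasWinding g k₂) : k₁ = k₂ := by
  obtain ⟨l₁, c₁, e₁, p₁⟩ := h₁
  obtain ⟨l₂, c₂, e₂, p₂⟩ := h₂
  have h : ∀ y, l₁ y - l₂ y = l₁ 0 - l₂ 0 :=
    eq_zero_apply_of_exp_eq_one (l := fun y => l₁ y - l₂ y) (c₁.sub c₂) fun y => by
      rw [exp_sub, e₁, e₂, div_self]
      rw [← e₂]
      exact exp_ne_zero _
  have h2 := h (0 + 2 * π)
  rw [p₁, p₂] at h2
  linear_combination h2

theorem exists_hasWinding {g : ℝ → ℂ} (hc : Continuous g) (h0 : ∀ y, g y ≠ 0)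
    (hp : ∀ y, g (y + 2 * π) = g y) : ∃ k, HasWinding g k := by
  have hsc : IsSimplyConnected (univ : Set ℝ) :=
    (Homeomorph.Set.univ ℝ).toHomotopyEquiv.simplyConnectedSpace_iff.2 inferInstance
  obtain ⟨l, hl, he⟩ := exists_continuousOn_eqOn_exp_comp hsc isOpen_univ hc.continuousOn
    (by rintro ⟨y, -, hy⟩; exact h0 y hy)
  have hl' : Continuous l := continuousOn_univ.1 hl
  have he' : ∀ y, exp (l y) = g y := fun y => he (mem_univ y)
  refine ⟨l (2 * π) - l 0, l, hl', he', fun y => ?_⟩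
  have := eq_zero_apply_of_exp_eq_one (l := fun y => l (y + 2 * π) - l y)
    (by fun_prop) (fun y => by
      rw [exp_sub, he', he', hp, div_self (h0 y)]) y
  simp only [zero_add] at this
  linear_combination this

theorem HasWinding.ne_zero_of_odd {g : ℝ → ℂ} {k : ℂ} (h : HasWinding g k)
    (hodd : ∀ y, g (-y) * g y = 1) (hne : g 0 ≠ g π) : k ≠ 0 := by
  rintro rfl
  obtain ⟨l, c, e, p⟩ := h
  have h1 := eq_zero_apply_of_exp_eq_one (l := fun y => l (-y) + l y)
    (by fun_prop) (fun y => by rw [exp_add, e, e, hodd]) π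
  simp only [neg_zero] at h1
  have h2 := p (-π)
  rw [show -π + 2 * π = π by ring, add_zero] at h2
  have h3 : l π = l 0 := by
    rw [← h2] at h1
    linear_combination h1 / 2
  exact hne (by rw [← e, ← e, h3])

/-- The functions `(1 - cΨ) / (Ψ - c)` for nearby parameters `c` have the same winding. -/
theorem HasWinding.eventually_param {Ψ : ℝ → ℂ} (hΨ : Continuous Ψ)
    (hp : ∀ y, Ψ (y + 2 * π) = Ψ y) {c₀ k : ℂ} (h1 : ∀ y, Ψ y - c₀ ≠ 0)
    (h2 : ∀ y, 1 - c₀ * Ψ y ≠ 0)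
    (h : HasWinding (fun y => (1 - c₀ * Ψ y) / (Ψ y - c₀)) k) :
    ∀ᶠ c in 𝓝 c₀, HasWinding (fun y => (1 - c * Ψ y) / (Ψ y - c)) k := by
  set Q : ℂ → ℝ → ℂ := fun c y =>
    ((1 - c * Ψ y) * (Ψ y - c₀)) / ((Ψ y - c) * (1 - c₀ * Ψ y)) with hQ
  have key : ∀ᶠ c in 𝓝 c₀, ∀ y ∈ Icc (0 : ℝ) (2 * π), Ψ y - c ≠ 0 ∧ Q c y ∈ slitPlane := by
    refine isCompact_Icc.eventually_forall_of_forall_eventually fun y _ => ?_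
    have hd : (Ψ y - c₀) * (1 - c₀ * Ψ y) ≠ 0 := mul_ne_zero (h1 y) (h2 y)
    have hA : ContinuousAt (fun z : ℂ × ℝ => Ψ z.2 - z.1) (c₀, y) := by fun_prop
    have hB : ContinuousAt (fun z : ℂ × ℝ => Q z.1 z.2) (c₀, y) := by
      refine ContinuousAt.div ?_ ?_ hd
      · fun_prop
      · fun_prop
    refine (hA.eventually_ne (h1 y)).and (hB.eventually (isOpen_slitPlane.mem_nhds ?_))
    have : Q c₀ y = 1 := by
      simp only [hQ]
      rw [mul_comm, div_self hd]
    change Q c₀ y ∈ slitPlane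
    rw [this]
    exact one_mem_slitPlane
  filter_upwards [key] with c hc
  have hper : ∀ P : ℂ → Prop, (∀ y ∈ Icc (0 : ℝ) (2 * π), P (Ψ y)) → ∀ y, P (Ψ y) := by
    intro P hP y
    have hper' : Function.Periodic Ψ (2 * π) := hp
    obtain ⟨y', hy', he⟩ := hper'.exists_mem_Ico₀ (by positivity) y
    rw [he]
    exact hP y' (Ico_subset_Icc_self hy')
  have hc1 : ∀ y, Ψ y - c ≠ 0 := hper (fun w => w - c ≠ 0) fun y hy => (hc y hy).1
  have hc2 : ∀ y, Q c y ∈ slitPlane :=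
    hper (fun w => ((1 - c * w) * (w - c₀)) / ((w - c) * (1 - c₀ * w)) ∈ slitPlane)
      fun y hy => (hc y hy).2
  have hQc : Continuous (Q c) := by
    refine Continuous.div ?_ ?_ fun y => mul_ne_zero (hc1 y) (h2 y)
    · fun_prop
    · fun_prop
  have hw := (hasWinding_of_mem_slitPlane hQc hc2 (fun y => by simp only [hQ, hp])).mul h
  rw [zero_add] at hw
  convert! hw using 2 with y
  have := hc1 y
  have := h1 y
  have := h2 y
  simp only [hQ]
  rw [div_mul_div_comm, div_eq_div_iff (by assumption) (by positivity)]
  ring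

theorem norm_sub_le_of_re_pos_of_strip {f : ℂ → ℂ} {ρ : ℝ} (hρ : 0 < ρ)
    (hf : DifferentiableOn ℂ f (re ⁻¹' Ioo 0 (2 * ρ)))
    (hpos : ∀ z ∈ re ⁻¹' Ioo 0 (2 * ρ), 0 < (f z).re) (y : ℝ) :
    ‖f (ρ + y * I + 2 * π * I) - f (ρ + y * I)‖ ≤
      (Real.exp (2 / ρ * (2 * π)) - 1) * (f (ρ + y * I)).re := by
  have hopen : IsOpen (re ⁻¹' Ioo 0 (2 * ρ)) := isOpen_Ioo.preimage continuous_re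
  set p : ℝ → ℂ := fun t => ρ + y * I + t * I with hp
  have hre : ∀ t, (p t).re = ρ := fun t => by simp [hp]
  have hball : ∀ t, ball (p t) ρ ⊆ re ⁻¹' Ioo 0 (2 * ρ) := fun t z hz => by
    have h1 : |(z - p t).re| < ρ := (abs_re_le_norm _).trans_lt (by simpa [dist_eq] using hz)
    rw [sub_re, hre, abs_lt] at h1
    exact ⟨by linarith, by linarith⟩
  have hmem : ∀ t, p t ∈ re ⁻¹' Ioo 0 (2 * ρ) := fun t => hball t (mem_ball_self hρ)
  have hdp : ∀ t, HasDerivAt p I t := fun t => by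
    have h1 : HasDerivAt (fun t : ℝ => (t : ℂ)) 1 t := ofRealCLM.hasDerivAt
    simpa [hp] using (h1.mul_const I).const_add (ρ + y * I : ℂ)
  have hdf : ∀ t, HasDerivAt (fun t => f (p t) - f (p 0)) (deriv f (p t) * I) t := fun t =>
    ((hf.differentiableAt (hopen.mem_nhds (hmem t))).hasDerivAt.comp t (hdp t)).sub_const _
  have hbd : ∀ t, ‖deriv f (p t)‖ ≤ 2 / ρ * (f (p t)).re := fun t =>
    norm_deriv_le_of_re_pos hρ (hf.mono (hball t)) fun z hz => hpos z (hball t hz)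
  have hK : 2 / ρ ≠ 0 := by positivity
  have hgr := norm_le_gronwallBound_of_norm_deriv_right_le
    (f := fun t => f (p t) - f (p 0)) (f' := fun t => deriv f (p t) * I) (δ := 0) (K := 2 / ρ)
    (ε := 2 / ρ * (f (p 0)).re) (a := 0) (b := 2 * π)
    (fun t _ => (hdf t).continuousAt.continuousWithinAt)
    (fun t _ => (hdf t).hasDerivWithinAt) (by simp) (fun t _ => by
      rw [norm_mul, norm_I, mul_one, ← mul_add]
      refine (hbd t).trans (mul_le_mul_of_nonneg_left ?_ (by positivity))
      have := (re_le_norm (f (p t) - f (p 0)))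
      rw [sub_re] at this
      linarith) (2 * π) ⟨by positivity, le_rfl⟩
  rw [gronwallBound_of_K_ne_0 hK] at hgr
  have hp0 : p 0 = ρ + y * I := by simp [hp]
  have hp1 : p (2 * π) = ρ + y * I + 2 * π * I := by simp [hp]
  simp only [hp0, hp1, sub_zero, zero_mul, zero_add] at hgr
  calc _ ≤ _ := hgr
    _ = _ := by field_simp

theorem exists_bound_of_periodic_of_strip {G : ℂ → ℂ} {a b : ℝ}
    (hG : ContinuousOn G (re ⁻¹' Icc a b)) (hper : ∀ z, G (z + 2 * π * I) = G z) :
    ∃ B, ∀ z ∈ re ⁻¹' Icc a b, ‖G z‖ ≤ B := by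
  have hK : IsCompact (Icc a b ×ℂ Icc 0 (2 * π)) := isCompact_Icc.reProdIm isCompact_Icc
  obtain ⟨B, hB⟩ := hK.exists_bound_of_continuousOn
    (hG.mono fun z hz => hz.1)
  refine ⟨B, fun z hz => ?_⟩
  have hp : Function.Periodic (fun t : ℝ => G (z.re + t * I)) (2 * π) := fun t => by
    have h := hper (z.re + t * I)
    simp only
    rw [← h]
    push_cast
    ring_nf
  obtain ⟨t, ht, he⟩ := hp.exists_mem_Ico₀ (by positivity) z.im
  simp only [re_add_im] at he
  rw [he]
  refine hB _ ⟨?_, ?_⟩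
  · simpa using hz
  · simpa using Ico_subset_Icc_self ht

theorem norm_le_exp_of_hasWinding {G : ℂ → ℂ} {δ ρ C : ℝ} {k : ℂ} (hρ : 0 < ρ) (hρδ : 2 * ρ < δ)
    (hC : 0 < C) (hG : DifferentiableOn ℂ G (re ⁻¹' Ioo (-δ) δ))
    (h0 : ∀ z ∈ re ⁻¹' Ioo (-δ) δ, G z ≠ 0) (hper : ∀ z, G (z + 2 * π * I) = G z)
    (hw : HasWinding (fun y => G (y * I)) k) (hle0 : ∀ y : ℝ, ‖G (y * I)‖ ≤ C)
    (hle1 : ∀ z : ℂ, z.re = 2 * ρ → ‖G z‖ ≤ C) {z : ℂ} (hz0 : 0 ≤ z.re) (hz1 : z.re ≤ ρ) :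
    ‖G z‖ ≤ 2 * C * Real.exp (-(‖k‖ / ((Real.exp (2 / ρ * (2 * π)) - 1) * ρ) * z.re)) := by
  set T : Set ℂ := re ⁻¹' Ioo (-δ) δ with hT
  have hTo : IsOpen T := isOpen_Ioo.preimage continuous_re
  have hTc : Convex ℝ T := (convex_Ioo _ _).linear_preimage reLm
  have hsub : re ⁻¹' Icc 0 (2 * ρ) ⊆ T := fun z hz => ⟨by linarith [hz.1], by linarith [hz.2]⟩
  have hline0 : ∀ z : ℂ, z.re = 0 → ‖G z‖ ≤ C := fun z hz => by
    have : z = z.im * I := by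
      conv_lhs => rw [← re_add_im z, hz]
      simp
    rw [this]
    exact hle0 _
  obtain ⟨B, hB⟩ := exists_bound_of_periodic_of_strip (hG.continuousOn.mono hsub) hper
  have hdc : ∀ b, b ≤ 2 * ρ → DiffContOnCl ℂ G (re ⁻¹' Ioo 0 b) := fun b hb => by
    refine DifferentiableOn.diffContOnCl (hG.mono ?_)
    refine Subset.trans (closure_minimal (preimage_mono Ioo_subset_Icc_self)
      (isClosed_Icc.preimage continuous_re)) ?_
    exact Subset.trans (preimage_mono (Icc_subset_Icc_right hb)) hsub
  have hmax : ∀ z ∈ re ⁻¹' Icc 0 (2 * ρ), ‖G z‖ ≤ C := fun z hz => by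
    refine PhragmenLindelof.vertical_strip (hdc _ le_rfl) ⟨0, by simp; positivity, 0, ?_⟩ hline0
      hle1 hz.1 hz.2
    refine Asymptotics.IsBigO.of_bound B ?_
    filter_upwards [mem_inf_of_right (mem_principal_self _)] with w hw
    simpa using hB w (preimage_mono Ioo_subset_Icc_self hw)
  obtain ⟨h, hh, he⟩ := exists_exp_eq_of_convex hTc hTo hG h0
  have hmemT : ∀ x y : ℝ, |x| ≤ ρ → (x + y * I : ℂ) ∈ T := fun x y hx => by
    rw [abs_le] at hx
    simp only [hT, mem_preimage, add_re, ofReal_re, mul_re, I_re, mul_zero, ofReal_im, I_im,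
      mul_one, sub_self, add_zero, mem_Ioo]
    constructor <;> linarith
  have hshift : ∀ z ∈ T, z + 2 * π * I ∈ T := fun z hz => by
    simpa [hT] using hz
  have hexp1 : ∀ z ∈ T, exp (h (z + 2 * π * I) - h z) = 1 := fun z hz => by
    rw [exp_sub, he _ (hshift z hz), he z hz, hper, div_self (h0 z hz)]
  have hcont : ContinuousOn (fun z => h (z + 2 * π * I) - h z) T :=
    (hh.continuousOn.comp (by fun_prop) hshift).sub hh.continuousOn
  have hy : ∀ y : ℝ, h (y * I + 2 * π * I) - h (y * I) = k := by
    have hm : ∀ y : ℝ, (y * I : ℂ) ∈ T := fun y => by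
      simpa using hmemT 0 y (by simpa using hρ.le)
    have h1 := eq_zero_apply_of_exp_eq_one
      (l := fun y : ℝ => h (y * I + 2 * π * I) - h (y * I))
      (hcont.comp_continuous (f := fun y : ℝ => (y * I : ℂ)) (by fun_prop) hm)
      (fun y => hexp1 _ (hm y))
    have h2 : HasWinding (fun y => G (y * I))
        (h ((0 : ℝ) * I + 2 * π * I) - h ((0 : ℝ) * I)) := by
      refine ⟨fun y => h (y * I),
        hh.continuousOn.comp_continuous (by fun_prop) hm, fun y => he _ (hm y), fun y => ?_⟩
      rw [← h1 y]
      push_cast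
      ring_nf
    rw [hw.unique h2]
    exact h1
  have hincr : ∀ y : ℝ, h (ρ + y * I + 2 * π * I) - h (ρ + y * I) = k := fun y => by
    have hm : ∀ s : ℝ, ((ρ * Real.sin s : ℝ) + y * I : ℂ) ∈ T := fun s => by
      refine hmemT _ _ ?_
      rw [abs_mul, abs_of_pos hρ]
      exact mul_le_of_le_one_right hρ.le (Real.abs_sin_le_one s)
    have h1 := eq_zero_apply_of_exp_eq_one
      (l := fun s : ℝ => h ((ρ * Real.sin s : ℝ) + y * I + 2 * π * I)
        - h ((ρ * Real.sin s : ℝ) + y * I))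
      (hcont.comp_continuous (f := fun s : ℝ => ((ρ * Real.sin s : ℝ) + y * I : ℂ))
        (by fun_prop) hm) (fun s => hexp1 _ (hm s)) (π / 2)
    simp only [Real.sin_pi_div_two, Real.sin_zero, mul_one, mul_zero, ofReal_zero, zero_add]
      at h1
    rw [h1, hy]
  have hE : 0 < Real.exp (2 / ρ * (2 * π)) - 1 := by
    have : 0 < 2 / ρ * (2 * π) := by positivity
    linarith [Real.add_one_lt_exp this.ne']
  set E := Real.exp (2 / ρ * (2 * π)) - 1 with hEdef
  have hIoo : re ⁻¹' Ioo 0 (2 * ρ) ⊆ T := Subset.trans (preimage_mono Ioo_subset_Icc_self) hsub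
  have hnorm : ∀ z ∈ T, ‖G z‖ = Real.exp (h z).re := fun z hz => by rw [← he z hz, norm_exp]
  have hdecay : ∀ z : ℂ, z.re = ρ → ‖G z‖ ≤ 2 * C * Real.exp (-(‖k‖ / E)) := fun z hz => by
    have h1 := norm_sub_le_of_re_pos_of_strip (f := fun z => (Real.log (2 * C) : ℂ) - h z) hρ
      ((differentiableOn_const _).sub (hh.mono hIoo)) (fun w hw => by
        have h2 := hmax w (preimage_mono Ioo_subset_Icc_self hw)
        rw [hnorm w (hIoo hw)] at h2
        have h3 : (h w).re < Real.log (2 * C) := by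
          rw [Real.lt_log_iff_exp_lt (by positivity)]
          linarith
        simpa using h3) z.im
    have hz' : (ρ + z.im * I : ℂ) = z := by rw [← hz, re_add_im]
    have h4 := hincr z.im
    rw [hz'] at h1 h4
    rw [← hEdef, sub_sub_sub_cancel_left, norm_sub_rev, h4, sub_re, ofReal_re] at h1
    have hzT : z ∈ T := hz' ▸ hmemT ρ z.im (abs_of_pos hρ).le
    rw [hnorm z hzT, ← Real.exp_log (show (0:ℝ) < 2 * C by positivity), ← Real.exp_add,
      Real.exp_le_exp]
    have : ‖k‖ / E ≤ Real.log (2 * C) - (h z).re := by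
      rw [div_le_iff₀ hE]
      linarith
    linarith
  have h3 := HadamardThreeLines.norm_le_interp_of_mem_verticalClosedStrip' (f := G) (z := z)
    (a := 2 * C) (b := 2 * C * Real.exp (-(‖k‖ / E))) hρ ⟨hz0, hz1⟩
    (hdc ρ (by linarith)) ⟨B, by
      rintro _ ⟨w, hw, rfl⟩
      exact hB w ⟨hw.1, hw.2.trans (by linarith)⟩⟩
    (fun w hw => (hline0 w hw).trans (by linarith)) (fun w hw => hdecay w hw)
  refine h3.trans_eq ?_
  rw [Real.mul_rpow (by positivity) (Real.exp_pos _).le, ← mul_assoc,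
    ← Real.rpow_add (by positivity), ← Real.exp_mul]
  simp only [sub_zero, sub_add_cancel, Real.rpow_one]
  congr 2
  field_simp

theorem cosh_mem_realSeg_iff {ζ : ℂ} : cosh ζ ∈ realSeg ↔ ζ.re = 0 := by
  constructor
  · rintro ⟨t, ht, he⟩
    have h1 : cos (ζ * I) = cos (Real.arccos t) := by
      rw [cos_mul_I, ← ofReal_cos, Real.cos_arccos ht.1 ht.2]
      exact he.symm
    obtain ⟨k, hk | hk⟩ := Complex.cos_eq_cos_iff.1 h1
    · simpa using (congrArg im hk).symm
    · simpa using (congrArg im hk).symm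
  · intro h
    refine ⟨Real.cos ζ.im, ⟨Real.neg_one_le_cos _, Real.cos_le_one _⟩, ?_⟩
    have : ζ = ζ.im * I := by
      conv_lhs => rw [← re_add_im ζ, h]
      simp
    conv_rhs => rw [this]
    rw [cosh_mul_I]
    exact ofReal_cos _

theorem eventually_cosh_mem_thickening {ε : ℝ} (hε : 0 < ε) :
    ∃ δ > 0, ∀ ζ ∈ re ⁻¹' Ioo (-δ) δ, cosh ζ ∈ thickening ε realSeg := by
  have hc : ContinuousAt (fun x : ℝ => |Real.cosh x - 1| + |Real.sinh x|) 0 := by fun_prop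
  have h1 : ∀ᶠ x in 𝓝 (0 : ℝ), |Real.cosh x - 1| + |Real.sinh x| < ε :=
    hc.eventually (gt_mem_nhds (by simpa using hε))
  obtain ⟨δ, hδ, h⟩ := Metric.eventually_nhds_iff.1 h1
  refine ⟨δ, hδ, fun ζ hζ => mem_thickening_iff.2 ⟨Real.cos ζ.im, ?_, ?_⟩⟩
  · exact ⟨_, ⟨Real.neg_one_le_cos _, Real.cos_le_one _⟩, rfl⟩
  · have h2 := h (y := ζ.re) (by simpa [abs_lt] using hζ)
    refine lt_of_le_of_lt ?_ h2
    have h3 : cosh ζ - (Real.cos ζ.im : ℝ) =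
        ((Real.cosh ζ.re - 1) * Real.cos ζ.im : ℝ) + (Real.sinh ζ.re * Real.sin ζ.im : ℝ) * I := by
      conv_lhs => rw [← re_add_im ζ]
      rw [cosh_add, cosh_mul_I, sinh_mul_I]
      simp only [re_add_im]
      push_cast
      ring
    rw [dist_eq, h3]
    refine (norm_add_le _ _).trans ?_
    rw [norm_mul, norm_I, mul_one, norm_real, norm_real, Real.norm_eq_abs, Real.norm_eq_abs,
      abs_mul, abs_mul]
    exact add_le_add (mul_le_of_le_one_right (abs_nonneg _) (Real.abs_cos_le_one _))
      (mul_le_of_le_one_right (abs_nonneg _) (Real.abs_sin_le_one _))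

theorem isCompact_realSeg : IsCompact realSeg :=
  isCompact_Icc.image continuous_ofReal

theorem convex_realSeg : Convex ℝ realSeg :=
  (convex_Icc (-1 : ℝ) 1).linear_image ofRealLI.toLinearMap

theorem one_mem_realSeg : (1 : ℂ) ∈ realSeg := ⟨1, by simp, by simp⟩

theorem neg_one_mem_realSeg : (-1 : ℂ) ∈ realSeg := ⟨-1, by simp, by simp⟩

theorem AnalyticArc.isCompact_arc (A : AnalyticArc) : IsCompact A.arc :=
  isCompact_realSeg.image_of_continuousOn (A.diff.continuousOn.mono A.seg_sub)

theorem AnalyticArc.notMem_arc (A : AnalyticArc) {t : ℂ} (ht : t ∈ A.U) (h : t ∉ realSeg) :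
    A.Ξ t ∉ A.arc := by
  rintro ⟨s, hs, he⟩
  exact h (A.inj (A.seg_sub hs) ht he ▸ hs)

/-- A function `Ψ` on a strip extending `φ ∘ Ξ ∘ cosh` from the right half of the strip. -/
structure Unif (A : AnalyticArc) (S : SqrtBranch A) (N : Set ℂ) (δ : ℝ) (Ψ : ℂ → ℂ) : Prop where
  pos : 0 < δ
  mem_U : ∀ ζ ∈ re ⁻¹' Ioo (-δ) δ, cosh ζ ∈ A.U
  mem_N : ∀ ζ ∈ re ⁻¹' Ioo (-δ) δ, A.Ξ (cosh ζ) ∈ N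
  diff : DifferentiableOn ℂ Ψ (re ⁻¹' Ioo (-δ) δ)
  quad : ∀ ζ ∈ re ⁻¹' Ioo (-δ) δ, Ψ ζ ^ 2 - 2 * A.Ξ (cosh ζ) * Ψ ζ + 1 = 0
  odd : ∀ ζ ∈ re ⁻¹' Ioo (-δ) δ, Ψ (-ζ) * Ψ ζ = 1
  periodic : ∀ ζ, Ψ (ζ + 2 * π * I) = Ψ ζ
  eq_phi : ∀ ζ ∈ re ⁻¹' Ioo 0 δ, Ψ ζ = S.φ (A.Ξ (cosh ζ))

theorem AnalyticArc.exists_sqrt_factor (A : AnalyticArc) {V : Set ℂ} (hVo : IsOpen V)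
    (hVc : Convex ℝ V) (hseg : realSeg ⊆ V) (hVU : V ⊆ A.U) :
    ∃ m : ℂ → ℂ, DifferentiableOn ℂ m V ∧ ∀ t ∈ V, (t ^ 2 - 1) * m t ^ 2 = A.Ξ t ^ 2 - 1 := by
  have h1 := hseg one_mem_realSeg
  have h2 := hseg neg_one_mem_realSeg
  have hd := A.diff.mono hVU
  have hi := A.inj.mono hVU
  have hne : ∀ a ∈ V, ∀ t ∈ V, dslope A.Ξ a t ≠ 0 := fun a ha t ht => by
    by_cases h : t = a
    · subst h
      rw [dslope_same]
      exact deriv_ne_zero_of_injOn hVo hd hi ht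
    · rw [dslope_of_ne _ h, slope_def_field]
      exact div_ne_zero (sub_ne_zero.2 fun he => h (hi ht ha he)) (sub_ne_zero.2 h)
  have hdd : ∀ a ∈ V, DifferentiableOn ℂ (dslope A.Ξ a) V := fun a ha =>
    (differentiableOn_dslope (hVo.mem_nhds ha)).2 hd
  obtain ⟨h, hh, he⟩ := exists_exp_eq_of_convex hVc hVo ((hdd 1 h1).mul (hdd (-1) h2))
    (fun t ht => mul_ne_zero (hne _ h1 _ ht) (hne _ h2 _ ht))
  refine ⟨fun t => exp (h t / 2), (hh.div_const 2).cexp, fun t ht => ?_⟩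
  have h3 := sub_smul_dslope A.Ξ 1 t
  have h4 := sub_smul_dslope A.Ξ (-1) t
  rw [A.map_one, smul_eq_mul] at h3
  rw [A.map_neg_one, smul_eq_mul] at h4
  have h5 : exp (h t / 2) ^ 2 = exp (h t) := by
    rw [← exp_nat_mul]
    congr 1
    push_cast
    ring
  have h6 := he t ht
  simp only [Pi.mul_apply] at h6
  simp only
  rw [h5, h6]
  linear_combination (t + 1) * dslope A.Ξ (-1) t * h3 + (A.Ξ t - 1) * h4

theorem cosh_add_two_pi_mul_I (ζ : ℂ) : cosh (ζ + 2 * π * I) = cosh ζ := by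
  simp [cosh_add, cosh_mul_I, sinh_mul_I]

theorem sinh_add_two_pi_mul_I (ζ : ℂ) : sinh (ζ + 2 * π * I) = sinh ζ := by
  simp [sinh_add, cosh_mul_I, sinh_mul_I]

theorem exists_unif (A : AnalyticArc) (S : SqrtBranch A) {N : Set ℂ} (hN : IsOpen N)
    (hAN : A.arc ⊆ N) : ∃ δ Ψ, Unif A S N δ Ψ := by
  have hW : IsOpen (A.U ∩ A.Ξ ⁻¹' N) := A.diff.continuousOn.isOpen_inter_preimage A.isOpen_U hN
  obtain ⟨ε, hε, hεW⟩ := isCompact_realSeg.exists_thickening_subset_open hW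
    (fun t ht => ⟨A.seg_sub ht, hAN ⟨t, ht, rfl⟩⟩)
  set V := thickening ε realSeg
  have hVo : IsOpen V := isOpen_thickening
  have hVU : V ⊆ A.U := fun t ht => (hεW ht).1
  obtain ⟨m, hm, hmeq⟩ := A.exists_sqrt_factor hVo (convex_realSeg.thickening ε)
    (self_subset_thickening hε _) hVU
  obtain ⟨δ, hδ, hV⟩ := eventually_cosh_mem_thickening hε
  have hcosh : DifferentiableOn ℂ cosh (re ⁻¹' Ioo (-δ) δ) := differentiable_cosh.differentiableOn
  have hX : DifferentiableOn ℂ (fun ζ => A.Ξ (cosh ζ)) (re ⁻¹' Ioo (-δ) δ) :=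
    (A.diff.mono hVU).comp hcosh hV
  have hM : DifferentiableOn ℂ (fun ζ => sinh ζ * m (cosh ζ)) (re ⁻¹' Ioo (-δ) δ) :=
    differentiable_sinh.differentiableOn.mul (hm.comp hcosh hV)
  have hsq : ∀ ζ ∈ re ⁻¹' Ioo (-δ) δ, (sinh ζ * m (cosh ζ)) ^ 2 = A.Ξ (cosh ζ) ^ 2 - 1 :=
    fun ζ hζ => by
      rw [← hmeq _ (hV ζ hζ), cosh_sq]
      ring
  have hsub : re ⁻¹' Ioo 0 δ ⊆ re ⁻¹' Ioo (-δ) δ :=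
    preimage_mono (Ioo_subset_Ioo_left (by linarith))
  have hcompl : ∀ ζ ∈ re ⁻¹' Ioo 0 δ, A.Ξ (cosh ζ) ∈ A.arcᶜ := fun ζ hζ =>
    A.notMem_arc (hVU (hV ζ (hsub hζ))) fun h => hζ.1.ne' (cosh_mem_realSeg_iff.1 h)
  have hpm : ∃ s : ℂ, s ^ 2 = 1 ∧ ∀ ζ ∈ re ⁻¹' Ioo 0 δ,
      S.sr (A.Ξ (cosh ζ)) = s * (sinh ζ * m (cosh ζ)) := by
    have hpre : IsPreconnected (re ⁻¹' Ioo 0 δ) :=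
      ((convex_Ioo 0 δ).linear_preimage reLm).isPreconnected
    have h := hpre.eq_or_eq_neg_of_sq_eq (f := fun ζ => S.sr (A.Ξ (cosh ζ)))
      (g := fun ζ => sinh ζ * m (cosh ζ))
      (S.diff.continuousOn.comp (hX.continuousOn.mono hsub) hcompl)
      (hM.continuousOn.mono hsub) (fun ζ hζ => ?_) (fun {ζ} hζ h0 => ?_)
    · obtain h | h := h
      · exact ⟨1, by simp, fun ζ hζ => by simpa using h hζ⟩
      · exact ⟨-1, by simp, fun ζ hζ => by simpa using h hζ⟩
    · simp only [Pi.pow_apply]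
      rw [S.sq _ (hcompl ζ hζ), hsq ζ (hsub hζ)]
    · have h1 := hsq ζ (hsub hζ)
      rw [h0] at h1
      have h2 : (A.Ξ (cosh ζ) - 1) * (A.Ξ (cosh ζ) + 1) = 0 := by linear_combination -h1
      obtain h3 | h3 := mul_eq_zero.1 h2
      · exact hcompl ζ hζ ⟨1, one_mem_realSeg, by rw [A.map_one]; exact (sub_eq_zero.1 h3).symm⟩
      · exact hcompl ζ hζ ⟨-1, neg_one_mem_realSeg,
          by rw [A.map_neg_one]; exact (eq_neg_of_add_eq_zero_left h3).symm⟩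
  obtain ⟨s, hs, hsr⟩ := hpm
  refine ⟨δ, fun ζ => A.Ξ (cosh ζ) + s * (sinh ζ * m (cosh ζ)), hδ, fun ζ hζ => hVU (hV ζ hζ),
    fun ζ hζ => (hεW (hV ζ hζ)).2, hX.add (hM.const_mul s), fun ζ hζ => ?_, fun ζ hζ => ?_,
    fun ζ => ?_, fun ζ hζ => ?_⟩
  · linear_combination s ^ 2 * hsq ζ hζ + (A.Ξ (cosh ζ) ^ 2 - 1) * hs
  · simp only [cosh_neg, sinh_neg]
    linear_combination -s ^ 2 * hsq ζ hζ - (A.Ξ (cosh ζ) ^ 2 - 1) * hs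
  · simp only [cosh_add_two_pi_mul_I, sinh_add_two_pi_mul_I]
  · rw [SqrtBranch.φ, hsr ζ hζ]

namespace Unif

variable {A : AnalyticArc} {S : SqrtBranch A} {N : Set ℂ} {δ : ℝ} {Ψ : ℂ → ℂ}

theorem differentiableOn_comp (h : Unif A S N δ Ψ) :
    DifferentiableOn ℂ (fun ζ => A.Ξ (cosh ζ)) (re ⁻¹' Ioo (-δ) δ) :=
  A.diff.comp differentiable_cosh.differentiableOn h.mem_U

theorem isOpen_strip (δ : ℝ) : IsOpen (re ⁻¹' Ioo (-δ) δ) := isOpen_Ioo.preimage continuous_re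

theorem mem_strip_mul_I (h : Unif A S N δ Ψ) (y : ℝ) : (y * I : ℂ) ∈ re ⁻¹' Ioo (-δ) δ := by
  simpa using h.pos

theorem comp_mem_arc_iff (h : Unif A S N δ Ψ) {ζ : ℂ} (hζ : ζ ∈ re ⁻¹' Ioo (-δ) δ) :
    A.Ξ (cosh ζ) ∈ A.arc ↔ ζ.re = 0 := by
  rw [← cosh_mem_realSeg_iff]
  refine ⟨fun h1 => ?_, fun h1 => ⟨_, h1, rfl⟩⟩
  by_contra h2
  exact A.notMem_arc (h.mem_U ζ hζ) h2 h1

theorem isOpen_image (h : Unif A S N δ Ψ) {ρ : ℝ} (hρ : ρ ≤ δ) :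
    IsOpen ((fun ζ => A.Ξ (cosh ζ)) '' (re ⁻¹' Ioo (-ρ) ρ)) := by
  have hpre : IsPreconnected (re ⁻¹' Ioo (-δ) δ) :=
    ((convex_Ioo (-δ) δ).linear_preimage reLm).isPreconnected
  obtain ⟨w, hw⟩ | ho := (h.differentiableOn_comp.analyticOnNhd
    (isOpen_strip δ)).is_constant_or_isOpen hpre
  · have h0 := hw _ (h.mem_strip_mul_I 0)
    have h1 := hw _ (h.mem_strip_mul_I π)
    simp only [ofReal_zero, zero_mul, cosh_zero, A.map_one] at h0
    simp only [cosh_mul_I, cos_pi, A.map_neg_one] at h1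
    rw [← h0] at h1
    norm_num at h1
  · exact ho _ (preimage_mono (Ioo_subset_Ioo (by linarith) hρ)) (isOpen_strip ρ)

theorem arc_subset_image {ρ : ℝ} (hρ : 0 < ρ) :
    A.arc ⊆ (fun ζ => A.Ξ (cosh ζ)) '' (re ⁻¹' Ioo (-ρ) ρ) := by
  rintro _ ⟨_, ⟨t, ht, rfl⟩, rfl⟩
  refine ⟨Real.arccos t * I, by simpa using hρ, ?_⟩
  simp only
  rw [cosh_mul_I, ← ofReal_cos, Real.cos_arccos ht.1 ht.2]

theorem image_diff_arc (h : Unif A S N δ Ψ) {ρ : ℝ} (hρ : ρ ≤ δ) :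
    ((fun ζ => A.Ξ (cosh ζ)) '' (re ⁻¹' Ioo (-ρ) ρ)) \ A.arc =
      (fun ζ => A.Ξ (cosh ζ)) '' (re ⁻¹' Ioo 0 ρ) := by
  have hsub : re ⁻¹' Ioo (-ρ) ρ ⊆ re ⁻¹' Ioo (-δ) δ :=
    preimage_mono (Ioo_subset_Ioo (by linarith) hρ)
  ext z
  constructor
  · rintro ⟨⟨ζ, hζ, rfl⟩, hz⟩
    simp only [h.comp_mem_arc_iff (hsub hζ)] at hz
    obtain h1 | h1 := lt_or_gt_of_ne hz
    · refine ⟨-ζ, ⟨?_, ?_⟩, by simp⟩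
      · simpa using h1
      · rw [neg_re]
        linarith [hζ.1]
    · exact ⟨ζ, ⟨h1, hζ.2⟩, rfl⟩
  · rintro ⟨ζ, hζ, rfl⟩
    have h1 : ζ ∈ re ⁻¹' Ioo (-ρ) ρ := ⟨by linarith [hζ.1, hζ.2], hζ.2⟩
    refine ⟨⟨ζ, h1, rfl⟩, ?_⟩
    simp only [h.comp_mem_arc_iff (hsub h1)]
    exact hζ.1.ne'

theorem isPreconnected_compl_arc (h : Unif A S N δ Ψ) : IsPreconnected A.arcᶜ := by
  set Ω := (fun ζ => A.Ξ (cosh ζ)) '' (re ⁻¹' Ioo (-δ) δ)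
  have hΩo : IsOpen Ω := h.isOpen_image le_rfl
  have hΩ : A.arc ⊆ Ω := arc_subset_image h.pos
  have hsub : re ⁻¹' Ioo 0 δ ⊆ re ⁻¹' Ioo (-δ) δ :=
    preimage_mono (Ioo_subset_Ioo_left (by linarith [h.pos]))
  have hW : IsPreconnected (Ω \ A.arc) := by
    rw [h.image_diff_arc le_rfl]
    exact ((convex_Ioo 0 δ).linear_preimage reLm).isPreconnected.image _
      (h.differentiableOn_comp.continuousOn.mono hsub)
  have hDo : IsOpen A.arcᶜ := A.isCompact_arc.isClosed.isOpen_compl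
  have key : ∀ u v : Set ℂ, IsOpen u → IsOpen v → A.arcᶜ ⊆ u ∪ v → A.arcᶜ ∩ (u ∩ v) = ∅ →
      Ω \ A.arc ⊆ u → A.arcᶜ ⊆ u := fun u v hu hv huv hd hWu => by
    have h1 := isPreconnected_iff_subset_of_disjoint.1 (isPreconnected_univ (α := ℂ))
      ((u ∩ A.arcᶜ) ∪ Ω) (v ∩ A.arcᶜ) ((hu.inter hDo).union hΩo) (hv.inter hDo) (fun z _ => by
        by_cases hz : z ∈ A.arc
        · exact Or.inl (Or.inr (hΩ hz))
        · obtain h2 | h2 := huv hz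
          · exact Or.inl (Or.inl ⟨h2, hz⟩)
          · exact Or.inr ⟨h2, hz⟩) (by
        rw [univ_inter, ← disjoint_iff_inter_eq_empty, disjoint_left]
        rintro z hz ⟨hzv, hzD⟩
        have : z ∈ u := hz.elim (fun h => h.1) fun h => hWu ⟨h, hzD⟩
        exact hd.subset ⟨hzD, this, hzv⟩)
    obtain h1 | h1 := h1
    · intro z hz
      exact (h1 (mem_univ z)).elim (fun h => h.1) fun h => hWu ⟨h, hz⟩
    · exact absurd ⟨1, one_mem_realSeg, rfl⟩ (h1 (mem_univ (A.Ξ 1))).2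
  rw [isPreconnected_iff_subset_of_disjoint]
  intro u v hu hv huv hd
  have hWD : Ω \ A.arc ⊆ A.arcᶜ := fun z hz => hz.2
  obtain h1 | h1 := isPreconnected_iff_subset_of_disjoint.1 hW u v hu hv (hWD.trans huv)
    (subset_eq_empty (inter_subset_inter_left _ hWD) hd)
  · exact Or.inl (key u v hu hv huv hd h1)
  · exact Or.inr (key v u hv hu (by rwa [union_comm]) (by rwa [inter_comm v u]) h1)

end Unif

namespace SqrtBranch

variable {A : AnalyticArc} (S : SqrtBranch A)

theorem phi_quad {e : ℂ} (he : e ∈ A.arcᶜ) : S.φ e ^ 2 - 2 * e * S.φ e + 1 = 0 := by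
  rw [φ]
  linear_combination S.sq e he

theorem phi_ne_zero {e : ℂ} (he : e ∈ A.arcᶜ) : S.φ e ≠ 0 := fun h => by
  simpa [h] using S.phi_quad he

theorem continuousAt_inv_phi {e : ℂ} (he : e ∈ A.arcᶜ) : ContinuousAt (fun e => (S.φ e)⁻¹) e := by
  have h1 : ContinuousAt S.sr e :=
    S.diff.continuousOn.continuousAt (A.isCompact_arc.isClosed.isOpen_compl.mem_nhds he)
  exact (continuousAt_id.add h1).inv₀ (S.phi_ne_zero he)

theorem tendsto_inv_phi : Tendsto (fun e => (S.φ e)⁻¹) (Bornology.cobounded ℂ) (𝓝 0) := by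
  have h1 : Tendsto (fun z => (1 + S.sr z / z)⁻¹ * z⁻¹) (Bornology.cobounded ℂ)
      (𝓝 ((1 + 1)⁻¹ * 0)) :=
    ((S.at_inf.const_add 1).inv₀ (by norm_num)).mul tendsto_inv₀_cobounded
  rw [mul_zero] at h1
  refine h1.congr' ?_
  filter_upwards [Bornology.isBounded_def.1 (Bornology.isBounded_singleton (x := (0 : ℂ)))] with z hz
  rw [← mul_inv, φ, add_mul, one_mul, div_mul_cancel₀ _ hz]

end SqrtBranch

namespace Unif

variable {A : AnalyticArc} {S : SqrtBranch A} {N : Set ℂ} {δ : ℝ} {Ψ : ℂ → ℂ}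

theorem ne_zero (h : Unif A S N δ Ψ) {ζ : ℂ} (hζ : ζ ∈ re ⁻¹' Ioo (-δ) δ) : Ψ ζ ≠ 0 :=
  right_ne_zero_of_mul_eq_one (h.odd ζ hζ)

theorem apply_zero (h : Unif A S N δ Ψ) : Ψ 0 = 1 := by
  have h1 := h.quad _ (h.mem_strip_mul_I 0)
  simp only [ofReal_zero, zero_mul, cosh_zero, A.map_one] at h1
  have h2 : (Ψ 0 - 1) ^ 2 = 0 := by linear_combination h1
  exact sub_eq_zero.1 (pow_eq_zero_iff two_ne_zero |>.1 h2)

theorem apply_pi (h : Unif A S N δ Ψ) : Ψ (π * I) = -1 := by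
  have h1 := h.quad _ (h.mem_strip_mul_I π)
  simp only [cosh_mul_I, cos_pi, A.map_neg_one] at h1
  have h2 : (Ψ (π * I) + 1) ^ 2 = 0 := by linear_combination h1
  exact eq_neg_of_add_eq_zero_left (pow_eq_zero_iff two_ne_zero |>.1 h2)

theorem sub_phi_ne_zero (h : Unif A S N δ Ψ) {ζ e : ℂ} (hζ : ζ ∈ re ⁻¹' Ioo (-δ) δ)
    (he : e ∈ A.arcᶜ) (hne : A.Ξ (cosh ζ) ≠ e) : Ψ ζ - S.φ e ≠ 0 := fun h0 => by
  have h1 := h.quad ζ hζ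
  have h2 := S.phi_quad he
  rw [sub_eq_zero.1 h0] at h1
  have h3 : (A.Ξ (cosh ζ) - e) * S.φ e = 0 := by linear_combination (h2 - h1) / 2
  exact (mul_ne_zero (sub_ne_zero.2 hne) (S.phi_ne_zero he)) h3

theorem one_sub_phi_mul_ne_zero (h : Unif A S N δ Ψ) {ζ e : ℂ} (hζ : ζ ∈ re ⁻¹' Ioo (-δ) δ)
    (he : e ∈ A.arcᶜ) (hne : A.Ξ (cosh ζ) ≠ e) : 1 - S.φ e * Ψ ζ ≠ 0 := fun h0 => by
  have h1 := h.quad ζ hζ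
  have h2 := S.phi_quad he
  have h3 : A.Ξ (cosh ζ) - e = 0 := by
    linear_combination (-S.φ e / 2) * h1 + Ψ ζ / 2 * h2 +
      (S.φ e / 2 - Ψ ζ / 2 + A.Ξ (cosh ζ) - e) * h0
  exact sub_ne_zero.2 hne h3

theorem continuous_boundary (h : Unif A S N δ Ψ) : Continuous fun y : ℝ => Ψ (y * I) :=
  h.diff.continuousOn.comp_continuous (by fun_prop) h.mem_strip_mul_I

theorem periodic_boundary (h : Unif A S N δ Ψ) (y : ℝ) :
    Ψ ((y + 2 * π : ℝ) * I) = Ψ (y * I) := by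
  rw [← h.periodic (y * I)]
  push_cast
  ring_nf

theorem boundary_ne (h : Unif A S N δ Ψ) {e : ℂ} (he : e ∈ A.arcᶜ) (y : ℝ) :
    A.Ξ (cosh (y * I)) ≠ e := fun h1 =>
  he (h1 ▸ (h.comp_mem_arc_iff (h.mem_strip_mul_I y)).2 (by simp))

theorem exists_winding (h : Unif A S N δ Ψ) : ∃ κ : ℂ, κ ≠ 0 ∧
    HasWinding (fun y => 1 / Ψ (y * I)) κ ∧ ∀ e ∈ A.arcᶜ,
      HasWinding (fun y => (Ψ (y * I) - S.φ e) / (1 - S.φ e * Ψ (y * I))) κ := by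
  have hnz : ∀ y : ℝ, Ψ (y * I) ≠ 0 := fun y => h.ne_zero (h.mem_strip_mul_I y)
  obtain ⟨κ, hκ⟩ := exists_hasWinding (g := fun y : ℝ => 1 / Ψ (y * I))
    (continuous_const.div h.continuous_boundary hnz) (fun y => one_div_ne_zero (hnz y))
    (fun y => by simp only [h.periodic_boundary])
  refine ⟨κ, hκ.ne_zero_of_odd (fun y => ?_) ?_, hκ, ?_⟩
  · have h1 := h.odd _ (h.mem_strip_mul_I y)
    rw [one_div_mul_one_div, one_div, inv_eq_one]
    convert! h1 using 3
    simp
  · simp only [ofReal_zero, zero_mul, h.apply_zero, h.apply_pi]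
    norm_num
  set Q : ℂ → ℂ → Prop := fun c k =>
    HasWinding (fun y : ℝ => (1 - c * Ψ (y * I)) / (Ψ (y * I) - c)) k with hQ
  have hform : ∀ e ∈ A.arcᶜ, (fun y : ℝ => (1 - (S.φ e)⁻¹ * Ψ (y * I)) / (Ψ (y * I) - (S.φ e)⁻¹))
      = fun y : ℝ => (Ψ (y * I) - S.φ e) / (1 - S.φ e * Ψ (y * I)) := fun e he => by
    funext y
    have h0 := S.phi_ne_zero he
    have h1 := h.one_sub_phi_mul_ne_zero (h.mem_strip_mul_I y) he (h.boundary_ne he y)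
    have h2 : Ψ (y * I) - (S.φ e)⁻¹ ≠ 0 := fun h3 => h1 (by
      rw [sub_eq_zero.1 h3, mul_inv_cancel₀ h0, sub_self])
    rw [div_eq_div_iff h2 h1]
    field_simp
    ring
  have hloc : ∀ e ∈ A.arcᶜ, ∀ k, Q (S.φ e)⁻¹ k → ∀ᶠ e' in 𝓝 e, Q (S.φ e')⁻¹ k :=
    fun e he k hk => by
      have h0 := S.phi_ne_zero he
      refine (S.continuousAt_inv_phi he).eventually (HasWinding.eventually_param
        h.continuous_boundary h.periodic_boundary (fun y h3 => ?_) (fun y h3 => ?_) hk)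
      · exact h.one_sub_phi_mul_ne_zero (h.mem_strip_mul_I y) he (h.boundary_ne he y) (by
          rw [sub_eq_zero.1 h3, mul_inv_cancel₀ h0, sub_self])
      · refine h.sub_phi_ne_zero (h.mem_strip_mul_I y) he (h.boundary_ne he y) ?_
        field_simp at h3
        linear_combination -h3
  have hinf : ∀ᶠ e in Bornology.cobounded ℂ, Q (S.φ e)⁻¹ κ :=
    S.tendsto_inv_phi.eventually (HasWinding.eventually_param
      h.continuous_boundary h.periodic_boundary (fun y => by simpa using hnz y) (by simp)
      (by simpa using hκ))
  have hDo : IsOpen A.arcᶜ := A.isCompact_arc.isClosed.isOpen_compl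
  have hex : ∀ e ∈ A.arcᶜ, ∃ k, Q (S.φ e)⁻¹ k := fun e he => by
    simp only [hQ]
    rw [hform e he]
    have h1 := fun y => h.one_sub_phi_mul_ne_zero (h.mem_strip_mul_I y) he (h.boundary_ne he y)
    refine exists_hasWinding (Continuous.div ?_ ?_ h1) (fun y => div_ne_zero
      (h.sub_phi_ne_zero (h.mem_strip_mul_I y) he (h.boundary_ne he y)) (h1 y)) (fun y => by
        simp only [h.periodic_boundary])
    · exact h.continuous_boundary.sub continuous_const
    · exact continuous_const.sub (continuous_const.mul h.continuous_boundary)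
  have hall : A.arcᶜ ⊆ {e | e ∈ A.arcᶜ ∧ Q (S.φ e)⁻¹ κ} := by
    obtain h1 | h1 := isPreconnected_iff_subset_of_disjoint.1 h.isPreconnected_compl_arc
      {e | e ∈ A.arcᶜ ∧ Q (S.φ e)⁻¹ κ} {e | e ∈ A.arcᶜ ∧ ∃ k, k ≠ κ ∧ Q (S.φ e)⁻¹ k}
      (isOpen_iff_mem_nhds.2 fun e he => Filter.inter_mem (hDo.mem_nhds he.1) (hloc e he.1 κ he.2))
      (isOpen_iff_mem_nhds.2 fun e he => by
        obtain ⟨k, hk, hQk⟩ := he.2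
        filter_upwards [hDo.mem_nhds he.1, hloc e he.1 k hQk] with e' h1 h2 using ⟨h1, k, hk, h2⟩)
      (fun e he => by
        obtain ⟨k, hk⟩ := hex e he
        by_cases hkκ : k = κ
        · exact Or.inl ⟨he, hkκ ▸ hk⟩
        · exact Or.inr ⟨he, k, hkκ, hk⟩)
      (by
        rw [← disjoint_iff_inter_eq_empty, disjoint_left]
        rintro e - ⟨⟨-, h1⟩, -, k, hk, h2⟩
        exact hk (h2.unique h1))
    · exact h1
    · obtain ⟨e, he, hQe⟩ := ((Filter.eventually_of_mem
        (Bornology.isBounded_def.1 A.isCompact_arc.isBounded) fun _ h => h).and hinf).exists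
      obtain ⟨-, k, hk, h2⟩ := h1 he
      exact absurd (h2.unique hQe) hk
  intro e he
  rw [← hform e he]
  exact (hall he).2

end Unif

theorem im_cosh (ζ : ℂ) : (cosh ζ).im = Real.sinh ζ.re * Real.sin ζ.im := by
  conv_lhs => rw [← re_add_im ζ]
  rw [cosh_add, cosh_mul_I, sinh_mul_I, ← ofReal_cosh, ← ofReal_sinh, ← ofReal_cos, ← ofReal_sin]
  simp
  rfl

theorem HasWinding.pow {g : ℝ → ℂ} {k : ℂ} (h : HasWinding g k) (n : ℕ) :
    HasWinding (fun y => g y ^ n) (n * k) := by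
  induction n with
  | zero => simpa using hasWinding_one
  | succ n ih =>
    simp only [pow_succ, Nat.cast_succ, add_mul, one_mul]
    exact ih.mul h

theorem HasWinding.multiset_prod {ι : Type*} {g : ι → ℝ → ℂ} {k : ℂ} (s : Multiset ι)
    (h : ∀ i ∈ s, HasWinding (g i) k) :
    HasWinding (fun y => (s.map fun i => g i y).prod) (s.card * k) := by
  induction s using Multiset.induction_on with
  | empty => simpa using hasWinding_one
  | cons a s ih =>
    simp only [Multiset.map_cons, Multiset.prod_cons, Multiset.card_cons, Nat.cast_succ, add_mul,
      one_mul]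
    rw [add_comm]
    exact (h a (s.mem_cons_self a)).mul (ih fun i hi => h i (Multiset.mem_cons_of_mem hi))

theorem differentiableOn_multiset_prod {ι : Type*} {g : ι → ℂ → ℂ} {T : Set ℂ} (s : Multiset ι)
    (h : ∀ i ∈ s, DifferentiableOn ℂ (g i) T) :
    DifferentiableOn ℂ (fun z => (s.map fun i => g i z).prod) T := by
  induction s using Multiset.induction_on with
  | empty => simp
  | cons a s ih =>
    simp only [Multiset.map_cons, Multiset.prod_cons]
    exact (h a (s.mem_cons_self a)).mul (ih fun i hi => h i (Multiset.mem_cons_of_mem hi))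

/-- The function `r_n` in the uniformizing coordinate of the strip. -/
def liftR {A : AnalyticArc} (S : SqrtBranch A) (Ψ : ℂ → ℂ) (v : ℂ[X]) (n : ℕ) (ζ : ℂ) : ℂ :=
  (1 / Ψ ζ) ^ (2 * n - v.natDegree) *
    ((v.roots.map fun e => (Ψ ζ - S.φ e) / (1 - S.φ e * Ψ ζ)).prod)

namespace Unif

variable {A : AnalyticArc} {S : SqrtBranch A} {N : Set ℂ} {δ : ℝ} {Ψ : ℂ → ℂ} {v : ℂ[X]}

theorem comp_ne_of_mem_roots (h : Unif A S N δ Ψ) (hv : ∀ z ∈ N, v.eval z ≠ 0) {e ζ : ℂ}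
    (he : e ∈ v.roots) (hζ : ζ ∈ re ⁻¹' Ioo (-δ) δ) : A.Ξ (cosh ζ) ≠ e := fun h1 =>
  hv _ (h.mem_N ζ hζ) (h1 ▸ (mem_roots'.1 he).2)

theorem notMem_arc_of_mem_roots (hv : ∀ z ∈ N, v.eval z ≠ 0) (hN : A.arc ⊆ N) {e : ℂ}
    (he : e ∈ v.roots) : e ∈ A.arcᶜ := fun h1 => hv _ (hN h1) (mem_roots'.1 he).2

theorem differentiableOn_liftR
    (hv : ∀ z ∈ N, v.eval z ≠ 0) (hN : A.arc ⊆ N) (n : ℕ)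
    (h : Unif A S N δ Ψ) :
    DifferentiableOn ℂ (liftR S Ψ v n) (re ⁻¹' Ioo (-δ) δ) := by
  refine (((differentiableOn_const _).div h.diff fun ζ hζ => h.ne_zero hζ).pow _).mul
    (differentiableOn_multiset_prod _ fun e he => DifferentiableOn.div ?_ ?_ fun ζ hζ => ?_)
  · exact h.diff.sub_const _
  · exact (h.diff.const_mul _).const_sub _
  · exact h.one_sub_phi_mul_ne_zero hζ (notMem_arc_of_mem_roots hv hN he)
      (h.comp_ne_of_mem_roots hv he hζ)

theorem liftR_ne_zero
    (hv : ∀ z ∈ N, v.eval z ≠ 0) (hN : A.arc ⊆ N) (n : ℕ)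
    (h : Unif A S N δ Ψ) {ζ : ℂ} (hζ : ζ ∈ re ⁻¹' Ioo (-δ) δ) :
    liftR S Ψ v n ζ ≠ 0 := by
  refine mul_ne_zero (pow_ne_zero _ (one_div_ne_zero (h.ne_zero hζ))) (Multiset.prod_ne_zero ?_)
  rw [Multiset.mem_map]
  rintro ⟨e, he, h0⟩
  have h1 := notMem_arc_of_mem_roots hv hN he
  have h2 := h.comp_ne_of_mem_roots hv he hζ
  exact div_ne_zero (h.sub_phi_ne_zero hζ h1 h2) (h.one_sub_phi_mul_ne_zero hζ h1 h2) h0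

theorem hasWinding_liftR
    (hv : ∀ z ∈ N, v.eval z ≠ 0) (hN : A.arc ⊆ N) (n : ℕ)
    {κ : ℂ} (hd : v.natDegree ≤ 2 * n)
    (h1 : HasWinding (fun y : ℝ => 1 / Ψ (y * I)) κ) (h2 : ∀ e ∈ A.arcᶜ,
      HasWinding (fun y : ℝ => (Ψ (y * I) - S.φ e) / (1 - S.φ e * Ψ (y * I))) κ) :
    HasWinding (fun y : ℝ => liftR S Ψ v n (y * I)) (2 * n * κ) := by
  have h3 := (h1.pow (2 * n - v.natDegree)).mul (HasWinding.multiset_prod v.roots fun e he =>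
    h2 e (notMem_arc_of_mem_roots hv hN he))
  convert! h3 using 1
  have h4 : Multiset.card v.roots = v.natDegree :=
    (splits_iff_card_roots.1 (IsAlgClosed.splits v))
  rw [h4, Nat.cast_sub hd]
  push_cast
  ring

theorem liftR_periodic (n : ℕ) (h : Unif A S N δ Ψ) (ζ : ℂ) :
    liftR S Ψ v n (ζ + 2 * π * I) = liftR S Ψ v n ζ := by
  simp only [liftR, h.periodic]

theorem liftR_eq_rFun (n : ℕ) (h : Unif A S N δ Ψ) {ζ : ℂ} (hζ : ζ ∈ re ⁻¹' Ioo 0 δ) :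
    liftR S Ψ v n ζ = rFun S v n (A.Ξ (cosh ζ)) := by
  simp only [liftR, rFun, h.eq_phi ζ hζ]

theorem norm_liftR_of_sq_eq_one
    (hv : ∀ z ∈ N, v.eval z ≠ 0) (hN : A.arc ⊆ N) (n : ℕ)
    (h : Unif A S N δ Ψ) {ζ : ℂ} (hζ : ζ ∈ re ⁻¹' Ioo (-δ) δ)
    (h1 : Ψ ζ ^ 2 = 1) : ‖liftR S Ψ v n ζ‖ = 1 := by
  have hΨ : ‖Ψ ζ‖ = 1 := by
    rw [← pow_eq_one_iff_of_nonneg (norm_nonneg _) two_ne_zero, ← norm_pow, h1, norm_one]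
  rw [liftR, norm_mul, norm_pow, norm_div, hΨ, norm_one, div_one, one_pow, one_mul,
    ← normHom_apply, map_multiset_prod, Multiset.map_map]
  refine Multiset.prod_eq_one fun x hx => ?_
  obtain ⟨e, he, rfl⟩ := Multiset.mem_map.1 hx
  have h2 := h.one_sub_phi_mul_ne_zero hζ (notMem_arc_of_mem_roots hv hN he)
      (h.comp_ne_of_mem_roots hv he hζ)
  have h3 : Ψ ζ - S.φ e = Ψ ζ * (1 - S.φ e * Ψ ζ) := by linear_combination S.φ e * h1
  simp only [Function.comp_apply, normHom_apply]
  rw [h3, mul_div_cancel_right₀ _ h2, hΨ]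

theorem liftR_eq_of_tendsto
    (hv : ∀ z ∈ N, v.eval z ≠ 0) (hN : A.arc ⊆ N) (n : ℕ)
    (h : Unif A S N δ Ψ) {l : Filter ℝ} [l.NeBot] (hl : l ≤ 𝓝 0) {y : ℝ}
    (hs : ∀ᶠ s in l, 0 < s * Real.sin y) (hy : Real.sin y ≠ 0) {w : ℂ}
    (hw : Tendsto (fun s : ℝ => rFun S v n (A.Ξ ((Real.cos y : ℝ) + s * I))) l (𝓝 w)) :
    liftR S Ψ v n (y * I) = w := by
  set F : Filter ℂ := map (fun s : ℝ => ((Real.cos y : ℝ) + s * I : ℂ)) l with hF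
  set L : Filter ℂ := 𝓝 (y * I) ⊓ comap cosh F with hL
  have hmem := h.mem_strip_mul_I y
  have hFle : F ≤ 𝓝 (cosh (y * I)) := by
    have hc : Continuous (fun s : ℝ => ((Real.cos y : ℝ) + s * I : ℂ)) := by fun_prop
    have h1 := (hc.tendsto 0).mono_left hl
    rw [cosh_mul_I, ← ofReal_cos]
    convert! h1 using 2
    simp
  have hmap : map cosh (𝓝 (y * I : ℂ)) = 𝓝 (cosh (y * I)) := by
    refine (hasStrictDerivAt_cosh (y * I)).map_nhds_eq ?_
    rw [sinh_mul_I, ← ofReal_sin]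
    exact mul_ne_zero (by exact_mod_cast hy) I_ne_zero
  have hne : L.NeBot := by
    have h1 : map cosh L = F := by
      rw [hL, Filter.push_pull, hmap]
      exact inf_of_le_right hFle
    have h2 : F.NeBot := by rw [hF]; infer_instance
    rw [← h1] at h2
    exact Filter.NeBot.of_map h2
  have hG : Tendsto (liftR S Ψ v n) L (𝓝 (liftR S Ψ v n (y * I))) :=
    ((h.differentiableOn_liftR hv hN n).continuousOn.continuousAt
      ((isOpen_strip δ).mem_nhds hmem)).tendsto.mono_left inf_le_left
  have hR : Tendsto (fun ζ => rFun S v n (A.Ξ (cosh ζ))) L (𝓝 w) := by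
    have h1 : Tendsto (fun t => rFun S v n (A.Ξ t)) F (𝓝 w) := tendsto_map'_iff.2 hw
    exact h1.comp (tendsto_comap.mono_left inf_le_right)
  refine tendsto_nhds_unique (hG.congr' ?_) hR
  have e1 : ∀ᶠ ζ in L, ζ ∈ re ⁻¹' Ioo (-δ) δ :=
    Filter.Eventually.filter_mono inf_le_left ((isOpen_strip δ).mem_nhds hmem)
  have e2 : ∀ᶠ ζ in L, 0 < Real.sin ζ.im * Real.sin y := by
    refine Filter.Eventually.filter_mono inf_le_left ?_
    have hc : ContinuousAt (fun ζ : ℂ => Real.sin ζ.im * Real.sin y) (y * I) := by fun_prop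
    refine hc.eventually (lt_mem_nhds ?_)
    simpa using mul_self_pos.2 hy
  have e3 : ∀ᶠ ζ in L, 0 < (cosh ζ).im * Real.sin y := by
    have h1 : ∀ᶠ t in F, 0 < t.im * Real.sin y := by
      rw [hF, Filter.eventually_map]
      simpa using hs
    exact (tendsto_comap.eventually h1).filter_mono inf_le_right
  filter_upwards [e1, e2, e3] with ζ h1 h2 h3
  refine h.liftR_eq_rFun n ⟨?_, h1.2⟩
  rw [im_cosh, mul_assoc] at h3
  exact Real.sinh_pos_iff.1 (pos_of_mul_pos_left h3 h2.le)

theorem norm_liftR_boundary_le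
    (hv : ∀ z ∈ N, v.eval z ≠ 0) (hN : A.arc ⊆ N) (n : ℕ)
    (h : Unif A S N δ Ψ) {rp rm : ℂ → ℂ} {C : ℝ} (hC : 1 ≤ C)
    (hp : BVplus A.Ξ (rFun S v n) rp) (hm : BVminus A.Ξ (rFun S v n) rm)
    (hb : ∀ t ∈ A.arc, ‖rp t‖ ≤ C ∧ ‖rm t‖ ≤ C) (y : ℝ) : ‖liftR S Ψ v n (y * I)‖ ≤ C := by
  obtain hy | hy := eq_or_ne (Real.sin y) 0
  · refine (h.norm_liftR_of_sq_eq_one hv hN n (h.mem_strip_mul_I y) ?_).trans_le hC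
    have hodd := h.odd _ (h.mem_strip_mul_I y)
    obtain ⟨k, hk⟩ := Real.sin_eq_zero_iff.1 hy
    have hper : Function.Periodic (fun y : ℝ => Ψ (y * I)) (2 * π) := h.periodic_boundary
    have h1 : Ψ (-(y * I)) = Ψ (y * I) := by
      have h2 := hper.int_mul k (-y)
      rw [← hk] at h2 ⊢
      rw [show -((k * π : ℝ) : ℝ) + k * (2 * π) = k * π by ring] at h2
      rw [h2]
      push_cast
      ring_nf
    rw [h1] at hodd
    rw [sq, hodd]
  · have hlt : (Real.cos y) ∈ Ioo (-1 : ℝ) 1 := by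
      have h1 := Real.sin_sq_add_cos_sq y
      have h2 : 0 < Real.sin y ^ 2 := by positivity
      constructor <;> nlinarith
    have hmem : A.Ξ (Real.cos y : ℝ) ∈ A.arc := ⟨_, ⟨_, Ioo_subset_Icc_self hlt, rfl⟩, rfl⟩
    obtain h0 | h0 := lt_or_gt_of_ne hy
    · rw [h.liftR_eq_of_tendsto hv hN n (l := 𝓝[<] 0) nhdsWithin_le_nhds ?_ hy (hm _ hlt)]
      · exact (hb _ hmem).2
      · filter_upwards [self_mem_nhdsWithin] with s hs using mul_pos_of_neg_of_neg hs h0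
    · rw [h.liftR_eq_of_tendsto hv hN n (l := 𝓝[>] 0) nhdsWithin_le_nhds ?_ hy (hp _ hlt)]
      · exact (hb _ hmem).1
      · filter_upwards [self_mem_nhdsWithin] with s hs using mul_pos hs h0

end Unif

theorem exists_rFun_decay (A : AnalyticArc) (S : SqrtBranch A) (P : VPData A S) :
    ∃ (N : Set ℂ) (δ : ℝ) (Ψ : ℂ → ℂ), Unif A S N δ Ψ ∧ ∃ c > 0, ∃ C > 0, ∃ N₀ : ℕ, ∀ n ≥ N₀,
      ∀ ζ : ℂ, 0 < ζ.re → ζ.re < δ / 4 →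
        ‖rFun S (P.v n) n (A.Ξ (cosh ζ))‖ ≤ C * Real.exp (-(c * n * ζ.re)) := by
  obtain ⟨N, hNo, hN, n₀, hv⟩ := P.zero_free
  obtain ⟨δ, Ψ, h⟩ := exists_unif A S hNo hN
  obtain ⟨κ, hκ, hκ1, hκ2⟩ := h.exists_winding
  obtain ⟨C, hC⟩ := P.bdd
  have hδ := h.pos
  set E := Real.exp (2 / (δ / 4) * (2 * π)) - 1 with hE
  have hEpos : 0 < E := by
    have : 0 < 2 / (δ / 4) * (2 * π) := by positivity
    linarith [Real.add_one_lt_exp this.ne']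
  set K : Set ℂ := (fun ζ => A.Ξ (cosh ζ)) '' ({2 * (δ / 4)} ×ℂ Icc 0 (2 * π)) with hK
  have hstrip : ∀ ζ : ℂ, ζ.re = 2 * (δ / 4) → ζ ∈ re ⁻¹' Ioo (-δ) δ := fun ζ hζ => by
    constructor <;> linarith
  have hKc : IsCompact K := (isCompact_singleton.reProdIm isCompact_Icc).image_of_continuousOn
    (h.differentiableOn_comp.continuousOn.mono fun ζ hζ => hstrip ζ hζ.1)
  have hKD : K ⊆ A.arcᶜ := by
    rintro _ ⟨ζ, hζ, rfl⟩ h1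
    have h2 : ζ.re = 2 * (δ / 4) := hζ.1
    have h3 := (h.comp_mem_arc_iff (hstrip ζ h2)).1 h1
    linarith
  have hKmem : ∀ ζ : ℂ, ζ.re = 2 * (δ / 4) → A.Ξ (cosh ζ) ∈ K := fun ζ hζ => by
    have hp : Function.Periodic (fun t : ℝ => A.Ξ (cosh (ζ.re + t * I))) (2 * π) := fun t => by
      simp only
      rw [← cosh_add_two_pi_mul_I (ζ.re + t * I)]
      push_cast
      ring_nf
    obtain ⟨t, ht, he⟩ := hp.exists_mem_Ico₀ (by positivity) ζ.im
    simp only [re_add_im] at he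
    rw [he]
    exact ⟨_, ⟨by simpa using hζ, by simpa using Ico_subset_Icc_self ht⟩, rfl⟩
  have hsmall := Metric.tendstoUniformlyOn_iff.1 (P.small K hKc hKD) 1 one_pos
  obtain ⟨n₁, hn₁⟩ := eventually_atTop.1 hsmall
  refine ⟨N, δ, Ψ, h, 2 * ‖κ‖ / (E * (δ / 4)), by positivity, 2 * max C 1, by positivity,
    max n₀ n₁, fun n hn ζ h0 h1 => ?_⟩
  have hvn := hv n (le_of_max_le_left hn)
  have h2 := norm_le_exp_of_hasWinding (ρ := δ / 4) (δ := δ) (C := max C 1) (by positivity)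
    (by linarith) (by positivity) (h.differentiableOn_liftR hvn hN n)
    (fun z hz => h.liftR_ne_zero hvn hN n hz) (h.liftR_periodic n)
    (Unif.hasWinding_liftR hvn hN n (P.deg_le n) hκ1 hκ2)
    (h.norm_liftR_boundary_le hvn hN n (le_max_right _ _) (P.bvp n) (P.bvm n)
      fun t ht => ⟨(hC n t ht).1.trans (le_max_left _ _), (hC n t ht).2.trans (le_max_left _ _)⟩)
    (fun z hz => by
      rw [h.liftR_eq_rFun n ⟨by linarith, by linarith⟩]
      have h3 := hn₁ n (le_of_max_le_right hn) _ (hKmem z hz)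
      simp only [Pi.zero_apply, dist_zero_left] at h3
      exact h3.le.trans (le_max_right _ _)) h0.le h1.le
  rw [h.liftR_eq_rFun n ⟨h0, by linarith⟩, ← hE] at h2
  refine h2.trans_eq ?_
  congr 3
  rw [norm_mul, norm_mul, norm_natCast, Complex.norm_ofNat]
  ring

theorem injOn_cosh : InjOn cosh (Ioi 0 ×ℂ Ioc (-π) π) := by
  rintro z ⟨hz, hz1, hz2⟩ w ⟨hw, hw1, hw2⟩ he
  have h1 : cos (z * I) = cos (w * I) := by rw [cos_mul_I, cos_mul_I, he]
  have hz : 0 < z.re := hz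
  have hw : 0 < w.re := hw
  obtain ⟨k, hk | hk⟩ := Complex.cos_eq_cos_iff.1 h1
  · have hre : z.re = w.re := by simpa using (congrArg im hk).symm
    have him : w.im = z.im - 2 * k * π := by
      have := congrArg re hk
      simp at this
      linarith
    have hk0 : k = 0 := by
      have hπ := Real.pi_pos
      have h2 : (k : ℝ) < 1 := by
        by_contra! h3
        nlinarith
      have h3 : (-1 : ℝ) < k := by
        by_contra! h3
        nlinarith
      have h4 : k < 1 := by exact_mod_cast h2
      have h5 : -1 < k := by exact_mod_cast h3
      omega
    refine Complex.ext hre ?_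
    rw [him, hk0]
    simp
  · have hre : w.re = -z.re := by simpa using (congrArg im hk)
    linarith

theorem lintegral_image_le_of_norm_deriv_le {f : ℂ → ℂ} {s : Set ℂ} {M : ℝ} (hs : MeasurableSet s)
    (hf : ∀ z ∈ s, DifferentiableAt ℂ f z) (hi : InjOn f s) (hM : ∀ z ∈ s, ‖deriv f z‖ ≤ M)
    (g : ℂ → ℝ≥0∞) :
    ∫⁻ z in f '' s, g z ≤ ENNReal.ofReal (M ^ 2) * ∫⁻ z in s, g (f z) := by
  have h1 := lintegral_image_eq_lintegral_abs_det_fderiv_mul volume hs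
    (fun z hz => ((hf z hz).hasDerivAt.hasFDerivAt.restrictScalars ℝ).hasFDerivWithinAt) hi g
  rw [h1, ← lintegral_const_mul' _ _ ENNReal.ofReal_ne_top]
  refine setLIntegral_mono' hs fun z hz => ?_
  gcongr
  have h2 : ((ContinuousLinearMap.toSpanSingleton ℂ (deriv f z)).restrictScalars ℝ).det
      = ‖deriv f z‖ ^ 2 := by
    simp [ContinuousLinearMap.det, LinearMap.det_restrictScalars, Algebra.norm_complex_eq,
      Complex.normSq_eq_norm_sq]
  rw [h2, abs_of_nonneg (by positivity)]
  exact pow_le_pow_left₀ (norm_nonneg _) (hM z hz) 2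

theorem setLIntegral_exp_neg_re_le {a ρ : ℝ} (ha : 0 < a) :
    ∫⁻ z in Ioo 0 ρ ×ℂ Ioc (-π) π, ENNReal.ofReal (Real.exp (-a * z.re)) ≤
      ENNReal.ofReal (2 * π / a) := by
  have h1 := volume_preserving_equiv_real_prod.setLIntegral_comp_preimage_emb
    measurableEquivRealProd.measurableEmbedding
    (fun p : ℝ × ℝ => ENNReal.ofReal (Real.exp (-a * p.1))) (Ioo 0 ρ ×ˢ Ioc (-π) π)
  have h2 : (measurableEquivRealProd ⁻¹' (Ioo 0 ρ ×ˢ Ioc (-π) π)) = Ioo 0 ρ ×ℂ Ioc (-π) π := rfl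
  rw [h2] at h1
  simp only [measurableEquivRealProd_apply] at h1
  rw [h1, Measure.volume_eq_prod, ← Measure.prod_restrict]
  have h3 := lintegral_prod_mul (μ := volume.restrict (Ioo 0 ρ)) (ν := volume.restrict (Ioc (-π) π))
    (f := fun x : ℝ => ENNReal.ofReal (Real.exp (-a * x))) (g := fun _ => 1)
    (by fun_prop) (by fun_prop)
  simp only [mul_one] at h3
  rw [h3, lintegral_const, one_mul, Measure.restrict_apply_univ, Real.volume_Ioc]
  have h4 : ∫⁻ x in Ioo 0 ρ, ENNReal.ofReal (Real.exp (-a * x)) ≤ ENNReal.ofReal (1 / a) := by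
    refine (lintegral_mono_set Ioo_subset_Ioi_self).trans_eq ?_
    rw [← ofReal_integral_eq_lintegral_ofReal (integrableOn_exp_mul_Ioi (by linarith) 0)
      (Eventually.of_forall fun x => (Real.exp_pos _).le), integral_exp_mul_Ioi (by linarith)]
    congr 1
    simp
  refine (mul_le_mul_left h4 _).trans_eq ?_
  rw [← ENNReal.ofReal_mul (by positivity)]
  congr 1
  ring

namespace Unif

variable {A : AnalyticArc} {S : SqrtBranch A} {N : Set ℂ} {δ : ℝ} {Ψ : ℂ → ℂ}

theorem image_strip_eq_image_rect (ρ : ℝ) :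
    (fun ζ => A.Ξ (cosh ζ)) '' (re ⁻¹' Ioo 0 ρ) =
      (fun ζ => A.Ξ (cosh ζ)) '' (Ioo 0 ρ ×ℂ Ioc (-π) π) := by
  refine Subset.antisymm ?_ (image_mono fun ζ hζ => hζ.1)
  rintro _ ⟨ζ, hζ, rfl⟩
  have hp : Function.Periodic (fun t : ℝ => A.Ξ (cosh (ζ.re + t * I))) (2 * π) := fun t => by
    simp only
    rw [← cosh_add_two_pi_mul_I (ζ.re + t * I)]
    push_cast
    ring_nf
  obtain ⟨t, ht, he⟩ := hp.exists_mem_Ioc (by positivity) ζ.im (-π)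
  simp only [re_add_im] at he
  simp only
  rw [he]
  refine ⟨_, ⟨by simpa using hζ, ?_⟩, rfl⟩
  rw [show -π + 2 * π = π by ring] at ht
  simpa using ht

theorem exists_norm_le (h : Unif A S N δ Ψ) {ρ : ℝ} (hρ : ρ < δ) :
    ∃ B, ∀ ζ ∈ re ⁻¹' Icc (-ρ) ρ, ‖A.Ξ (cosh ζ)‖ ≤ B ∧ ‖deriv (fun ζ => A.Ξ (cosh ζ)) ζ‖ ≤ B := by
  have hsub : re ⁻¹' Icc (-ρ) ρ ⊆ re ⁻¹' Ioo (-δ) δ :=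
    preimage_mono (Icc_subset_Ioo (by linarith) hρ)
  have hper : ∀ ζ, A.Ξ (cosh (ζ + 2 * π * I)) = A.Ξ (cosh ζ) := fun ζ => by
    rw [cosh_add_two_pi_mul_I]
  obtain ⟨B₁, h₁⟩ := exists_bound_of_periodic_of_strip
    (h.differentiableOn_comp.continuousOn.mono hsub) hper
  obtain ⟨B₂, h₂⟩ := exists_bound_of_periodic_of_strip
    ((h.differentiableOn_comp.deriv (isOpen_strip δ)).continuousOn.mono hsub) (fun ζ => by
      rw [← deriv_comp_add_const]
      simp only [hper])
  exact ⟨max B₁ B₂, fun ζ hζ =>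
    ⟨(h₁ ζ hζ).trans (le_max_left _ _), (h₂ ζ hζ).trans (le_max_right _ _)⟩⟩

end Unif

end AreaBound

/-- **Area `L^q` smallness of the functions `r_n` near the arc.**
If `{v_n} ∈ V_P(Δ)` with associated functions `r_n`, then there is a bounded open
neighborhood `Ω` of `Δ` such that for every `q ∈ [1,∞)` one has
`‖r_n‖_{L^q(Ω \ Δ)} ≤ C_q n^{-1/q}` for all `n` large enough. -/
theorem rFun_area_Lq_bound (A : AnalyticArc) (S : SqrtBranch A) (P : VPData A S) :
    ∃ Ω : Set ℂ, IsOpen Ω ∧ Bornology.IsBounded Ω ∧ A.arc ⊆ Ω ∧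
      ∀ q : ℝ, 1 ≤ q → ∃ C : ℝ, 0 < C ∧ ∃ N : ℕ, ∀ n ≥ N,
        (∫⁻ z in Ω \ A.arc, ENNReal.ofReal (‖rFun S (P.v n) n z‖ ^ q)) ^ (1 / q) ≤
          ENNReal.ofReal (C * (n : ℝ) ^ (-(1 / q))) := by
  obtain ⟨N, δ, Ψ, h, c, hc, C, hC, n₀, hdecay⟩ := exists_rFun_decay A S P
  have hδ := h.pos
  obtain ⟨B, hB⟩ := h.exists_norm_le (ρ := δ / 4) (by linarith)
  set M := max B 1
  have hM : 0 < M := by positivity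
  refine ⟨(fun ζ => A.Ξ (cosh ζ)) '' (re ⁻¹' Ioo (-(δ / 4)) (δ / 4)),
    h.isOpen_image (by linarith), ?_, Unif.arc_subset_image (by linarith), fun q hq => ?_⟩
  · refine isBounded_iff_forall_norm_le.2 ⟨B, ?_⟩
    rintro _ ⟨ζ, hζ, rfl⟩
    exact (hB ζ (preimage_mono Ioo_subset_Icc_self hζ)).1
  have hq0 : 0 < q := by linarith
  rw [h.image_diff_arc (by linarith), Unif.image_strip_eq_image_rect]
  refine ⟨(M ^ 2 * (C ^ q * (2 * Real.pi / (c * q)))) ^ (1 / q), by positivity, max n₀ 1,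
    fun n hn => ?_⟩
  have hn0 : 0 < (n : ℝ) := by exact_mod_cast (le_of_max_le_right hn : 1 ≤ n)
  have hstrip : ∀ ζ ∈ Ioo 0 (δ / 4) ×ℂ Ioc (-Real.pi) Real.pi, ζ ∈ re ⁻¹' Ioo (-δ) δ := fun ζ hζ =>
    ⟨by linarith [hζ.1.1], by linarith [hζ.1.2]⟩
  have hms : MeasurableSet (Ioo 0 (δ / 4) ×ℂ Ioc (-Real.pi) Real.pi) :=
    (measurableSet_Ioo.preimage measurable_re).inter (measurableSet_Ioc.preimage measurable_im)
  have h1 := lintegral_image_le_of_norm_deriv_le (M := M) hms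
    (fun ζ hζ => h.differentiableOn_comp.differentiableAt
      ((Unif.isOpen_strip δ).mem_nhds (hstrip ζ hζ)))
    (fun z hz w hw he => injOn_cosh ⟨hz.1.1, hz.2⟩ ⟨hw.1.1, hw.2⟩
      (A.inj (h.mem_U z (hstrip z hz)) (h.mem_U w (hstrip w hw)) he))
    (fun ζ hζ => (hB ζ ⟨by linarith [hζ.1.1], hζ.1.2.le⟩).2.trans (le_max_left _ _))
    (fun z => ENNReal.ofReal (‖rFun S (P.v n) n z‖ ^ q))
  have h2 : ∫⁻ ζ in Ioo 0 (δ / 4) ×ℂ Ioc (-Real.pi) Real.pi,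
      ENNReal.ofReal (‖rFun S (P.v n) n (A.Ξ (cosh ζ))‖ ^ q) ≤
      ENNReal.ofReal (C ^ q) * ENNReal.ofReal (2 * Real.pi / (c * n * q)) := by
    refine le_trans ?_ (mul_le_mul_right (setLIntegral_exp_neg_re_le (a := c * n * q)
      (ρ := δ / 4) (by positivity)) _)
    rw [← lintegral_const_mul' _ _ ENNReal.ofReal_ne_top]
    refine setLIntegral_mono' hms fun ζ hζ => ?_
    rw [← ENNReal.ofReal_mul (by positivity)]
    refine ENNReal.ofReal_le_ofReal ?_
    refine (Real.rpow_le_rpow (norm_nonneg _) (hdecay n (le_of_max_le_left hn) ζ hζ.1.1 hζ.1.2)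
      hq0.le).trans_eq ?_
    rw [Real.mul_rpow hC.le (Real.exp_pos _).le, ← Real.exp_mul]
    congr 2
    ring
  calc _ ≤ (ENNReal.ofReal (M ^ 2) *
        (ENNReal.ofReal (C ^ q) * ENNReal.ofReal (2 * Real.pi / (c * n * q)))) ^ (1 / q) := by
        refine ENNReal.rpow_le_rpow (h1.trans ?_) (by positivity)
        gcongr
    _ = _ := by
        rw [← ENNReal.ofReal_mul (by positivity), ← ENNReal.ofReal_mul (by positivity),
          ENNReal.ofReal_rpow_of_nonneg (by positivity) (by positivity), Real.rpow_neg hn0.le,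
          ← Real.inv_rpow hn0.le, ← Real.mul_rpow (by positivity) (by positivity)]
        congr 2
        field_simp

end
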